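/- Let n ≥ 1, Xₙ = Fin n discrete, Y = S¹ the unit circle, Y₁ = {y₀} for a point y₀ ∈ S¹, and Z = Xₙ × Y. Then the quotient space Z/∼ (the wedge of n circles joined at the point coming from y₀) has fundamental group (based at the wedge point) isomorphic to the free group on n generators. -/

import Mathlib

/-- The identification relation on `Fin n × Y`: `(x', y') ∼ (x'', y'')` iff
`y' = y''` and (`y' ∈ Y₁` or `x' = x''`). -/
def paperRel (n : ℕ) {Y : Type*} (Y₁ : Set Y) (z₁ z₂ : Fin n × Y) : Prop :=
  z₁.2 = z₂.2 ∧ (z₁.2 ∈ Y₁ ∨ z₁.1 = z₂.1)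

namespace WedgeCover

open Topology unitInterval

variable {n : ℕ}

/-- Disjoint union of the edges of the Cayley graph; the edge `(g, i)` goes from `g`
to `aᵢ * g`. -/
abbrev Pre (n : ℕ) := Σ _ : FreeGroup (Fin n) × Fin n, I

/-- Gluing the edges along vertices. -/
inductive Rel : Pre n → Pre n → Prop
  | zero (g : FreeGroup (Fin n)) (i j : Fin n) : Rel ⟨(g, i), 0⟩ ⟨(g, j), 0⟩
  | one (g : FreeGroup (Fin n)) (i j : Fin n) : Rel ⟨(g, i), 1⟩ ⟨(FreeGroup.of i * g, j), 0⟩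

/-- The Cayley tree. -/
def Tree (n : ℕ) := Quot (Rel (n := n))

instance : TopologicalSpace (Tree n) := inferInstanceAs (TopologicalSpace (Quot _))

/-- Point on an edge. -/
def pt (g : FreeGroup (Fin n)) (i : Fin n) (s : I) : Tree n := Quot.mk _ ⟨(g, i), s⟩

theorem pt_zero (g : FreeGroup (Fin n)) (i j : Fin n) : pt g i 0 = pt g j 0 :=
  Quot.sound (.zero g i j)

theorem pt_one (g : FreeGroup (Fin n)) (i j : Fin n) :
    pt g i 1 = pt (FreeGroup.of i * g) j 0 :=
  Quot.sound (.one g i j)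

@[fun_prop]
theorem continuous_pt (g : FreeGroup (Fin n)) (i : Fin n) : Continuous (pt g i) :=
  continuous_quot_mk.comp (continuous_sigmaMk (ι := FreeGroup (Fin n) × Fin n) (i := (g, i)))

theorem exists_pt (e : Tree n) : ∃ g i s, e = pt g i s := by
  induction e using Quot.ind with
  | mk a => exact ⟨a.1.1, a.1.2, a.2, rfl⟩

/-- Maps out of the tree. -/
def lift {α : Type*} (f : FreeGroup (Fin n) → Fin n → I → α)
    (V : FreeGroup (Fin n) → α) (h0 : ∀ g i, f g i 0 = V g)
    (h1 : ∀ g i, f g i 1 = V (FreeGroup.of i * g)) : Tree n → α :=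
  Quot.lift (fun a => f a.1.1 a.1.2 a.2) (by
    rintro _ _ (⟨g, i, j⟩ | ⟨g, i, j⟩)
    · exact (h0 g i).trans (h0 g j).symm
    · exact (h1 g i).trans (h0 _ j).symm)

theorem continuous_lift {α : Type*} [TopologicalSpace α] (f : FreeGroup (Fin n) → Fin n → I → α)
    (V : FreeGroup (Fin n) → α) (h0 : ∀ g i, f g i 0 = V g)
    (h1 : ∀ g i, f g i 1 = V (FreeGroup.of i * g)) (hf : ∀ g i, Continuous (f g i)) :
    Continuous (lift f V h0 h1) :=
  continuous_quot_lift _ (continuous_sigma fun a => hf a.1 a.2)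

variable [NeZero n]

/-- vertices -/
def vtx (g : FreeGroup (Fin n)) : Tree n := pt g 0 0

theorem pt_zero' (g : FreeGroup (Fin n)) (i : Fin n) : pt g i 0 = vtx g := pt_zero _ _ _

theorem pt_one' (g : FreeGroup (Fin n)) (i : Fin n) :
    pt g i 1 = vtx (FreeGroup.of i * g) := pt_one _ _ _

instance : MulAction (FreeGroup (Fin n)) (Tree n) where
  smul k := lift (fun g i s => pt (g * k⁻¹) i s) (fun g => vtx (g * k⁻¹))
    (fun g i => pt_zero' _ _) (fun g i => by rw [pt_one', mul_assoc])
  one_smul e := by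
    obtain ⟨g, i, s, rfl⟩ := exists_pt e
    change pt (g * 1⁻¹) i s = _
    simp
  mul_smul k l e := by
    obtain ⟨g, i, s, rfl⟩ := exists_pt e
    change pt (g * (k * l)⁻¹) i s = pt (g * l⁻¹ * k⁻¹) i s
    simp [mul_assoc]

theorem smul_pt (k g : FreeGroup (Fin n)) (i : Fin n) (s : I) :
    k • pt g i s = pt (g * k⁻¹) i s := rfl

theorem smul_vtx (k g : FreeGroup (Fin n)) : k • vtx g = vtx (g * k⁻¹) := rfl

instance : ContinuousConstSMul (FreeGroup (Fin n)) (Tree n) where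
  continuous_const_smul k := continuous_lift _ _ _ _ fun g i => continuous_pt _ _

/-! ### Separation -/

open Classical in
/-- closeness to a vertex -/
noncomputable def nearV (k : FreeGroup (Fin n)) : Tree n → ℝ :=
  lift (fun g i s => (if g = k then 1 - (s : ℝ) else 0) +
    (if FreeGroup.of i * g = k then (s : ℝ) else 0)) (fun g => if g = k then 1 else 0)
    (by intro g i; simp) (by intro g i; simp)

open Classical in
theorem nearV_pt (k g : FreeGroup (Fin n)) (i : Fin n) (s : I) :
    nearV k (pt g i s) = (if g = k then 1 - (s : ℝ) else 0) +
      (if FreeGroup.of i * g = k then (s : ℝ) else 0) := rfl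

theorem continuous_nearV (k : FreeGroup (Fin n)) : Continuous (nearV k) := by
  refine continuous_lift _ _ _ _ fun g i => ?_
  split_ifs <;> fun_prop

open Classical in
/-- edge bump -/
noncomputable def nearE (k : FreeGroup (Fin n)) (j : Fin n) : Tree n → ℝ :=
  lift (fun g i s => if g = k ∧ i = j then (s : ℝ) * (1 - s) else 0) (fun _ => 0)
    (by intro g i; simp) (by intro g i; simp)

open Classical in
theorem nearE_pt (k g : FreeGroup (Fin n)) (i j : Fin n) (s : I) :
    nearE k j (pt g i s) = if g = k ∧ i = j then (s : ℝ) * (1 - s) else 0 := rfl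

theorem continuous_nearE (k : FreeGroup (Fin n)) (j : Fin n) : Continuous (nearE k j) := by
  refine continuous_lift _ _ _ _ fun g i => ?_
  split_ifs <;> fun_prop

theorem nearV_smul (k l : FreeGroup (Fin n)) (e : Tree n) :
    nearV k (l • e) = nearV (k * l) e := by
  obtain ⟨g, i, s, rfl⟩ := exists_pt e
  simp only [smul_pt, nearV_pt, mul_inv_eq_iff_eq_mul, ← mul_assoc]

theorem nearE_smul (k l : FreeGroup (Fin n)) (j : Fin n) (e : Tree n) :
    nearE k j (l • e) = nearE (k * l) j e := by
  obtain ⟨g, i, s, rfl⟩ := exists_pt e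
  simp only [smul_pt, nearE_pt, mul_inv_eq_iff_eq_mul]

theorem nearV_unique (k l : FreeGroup (Fin n)) (e : Tree n) (hk : 1 / 2 < nearV k e)
    (hl : 1 / 2 < nearV l e) : k = l := by
  obtain ⟨g, i, s, rfl⟩ := exists_pt e
  have h0 := s.2.1
  have h1 := s.2.2
  simp only [nearV_pt] at hk hl
  by_contra hne
  split_ifs at hk hl <;> first | linarith | (exfalso; apply hne; simp_all)

theorem nearE_unique (k l : FreeGroup (Fin n)) (j : Fin n) (e : Tree n) (hk : 0 < nearE k j e)
    (hl : 0 < nearE l j e) : k = l := by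
  obtain ⟨g, i, s, rfl⟩ := exists_pt e
  simp only [nearE_pt] at hk hl
  split_ifs at hk hl with h h'
  · exact h.1.symm.trans h'.1
  all_goals exact absurd ‹(0 : ℝ) < 0› (lt_irrefl _)

theorem vtx_or (e : Tree n) :
    (∃ g, e = vtx g) ∨ ∃ g i, ∃ s : I, 0 < s ∧ s < 1 ∧ e = pt g i s := by
  obtain ⟨g, i, s, rfl⟩ := exists_pt e
  rcases eq_or_ne s 0 with rfl | h0
  · exact .inl ⟨_, pt_zero' _ _⟩
  rcases eq_or_ne s 1 with rfl | h1
  · exact .inl ⟨_, pt_one' _ _⟩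
  exact .inr ⟨g, i, s, unitInterval.pos_iff_ne_zero.2 h0, unitInterval.lt_one_iff_ne_one.2 h1, rfl⟩

theorem exists_disjoint (e : Tree n) : ∃ U ∈ 𝓝 e, ∀ g : FreeGroup (Fin n),
    ((g • ·) '' U ∩ U).Nonempty → g = 1 := by
  rcases vtx_or e with ⟨k, rfl⟩ | ⟨k, i, s, h0, h1, rfl⟩
  · refine ⟨{e | 1 / 2 < nearV k e},
      (isOpen_lt continuous_const (continuous_nearV k)).mem_nhds ?_, ?_⟩
    · change 1 / 2 < nearV k (pt k 0 0)
      rw [nearV_pt, if_pos rfl]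
      split_ifs <;> norm_num
    · rintro g ⟨_, ⟨e, he, rfl⟩, he'⟩
      simp only [Set.mem_ofPred_eq, nearV_smul] at he he'
      simpa using nearV_unique _ _ _ he he'
  · refine ⟨{e | 0 < nearE k i e},
      (isOpen_lt continuous_const (continuous_nearE k i)).mem_nhds ?_, ?_⟩
    · change 0 < nearE k i (pt k i s)
      rw [nearE_pt, if_pos ⟨rfl, rfl⟩]
      have h0' : (0 : ℝ) < s := h0
      have h1' : (s : ℝ) < 1 := h1
      exact mul_pos h0' (by linarith)
    · rintro g ⟨_, ⟨e, he, rfl⟩, he'⟩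
      simp only [Set.mem_ofPred_eq, nearE_smul] at he he'
      simpa using nearE_unique _ _ _ _ he he'

/-! ### Contractibility -/

/-- Point on an edge, clamped parameter. -/
noncomputable def ptR (g : FreeGroup (Fin n)) (i : Fin n) (s : ℝ) : Tree n :=
  pt g i (Set.projIcc 0 1 zero_le_one s)

omit [NeZero n] in
@[fun_prop]
theorem continuous_ptR (g : FreeGroup (Fin n)) (i : Fin n) : Continuous (ptR g i) :=
  (continuous_pt g i).comp continuous_projIcc

omit [NeZero n] in
theorem ptR_coe (g : FreeGroup (Fin n)) (i : Fin n) (s : I) : ptR g i s = pt g i s := by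
  simp [ptR]

theorem ptR_zero (g : FreeGroup (Fin n)) (i : Fin n) : ptR g i 0 = vtx g := by
  rw [← pt_zero' g i, ← ptR_coe]; rfl

theorem ptR_one (g : FreeGroup (Fin n)) (i : Fin n) : ptR g i 1 = vtx (FreeGroup.of i * g) := by
  rw [← pt_one' g i, ← ptR_coe]; rfl

/-- First step of the geodesic to the root. -/
noncomputable def step : Fin n × Bool → FreeGroup (Fin n) → ℝ → Tree n
  | (i, true), g, t => ptR g i (1 - t)
  | (i, false), g, t => ptR ((FreeGroup.of i)⁻¹ * g) i t

theorem step_one (x : Fin n × Bool) (g : FreeGroup (Fin n)) : step x g 1 = vtx g := by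
  rcases x with ⟨i, _ | _⟩ <;> simp [step, ptR_zero, ptR_one]

theorem step_zero (x : Fin n × Bool) (L : List (Fin n × Bool)) :
    step x (FreeGroup.mk L) 0 = vtx (FreeGroup.mk (x :: L)) := by
  rcases x with ⟨i, _ | _⟩
  · rw [step, ptR_zero]; rfl
  · rw [step, sub_zero, ptR_one]; rfl

omit [NeZero n] in
theorem continuous_step (x : Fin n × Bool) (g : FreeGroup (Fin n)) : Continuous (step x g) := by
  rcases x with ⟨i, _ | _⟩
  · exact continuous_ptR _ i
  · exact (continuous_ptR g i).comp (continuous_const.sub continuous_id)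

/-- Geodesic to the root. -/
noncomputable def geo : List (Fin n × Bool) → ℝ → Tree n
  | [], _ => vtx 1
  | x :: L, t => if t ≤ 1 then step x (FreeGroup.mk L) t else geo L (t - 1)

theorem geo_zero (L : List (Fin n × Bool)) : geo L 0 = vtx (FreeGroup.mk L) := by
  cases L with
  | nil => rfl
  | cons x L => simp [geo, step_zero]

theorem geo_length (L : List (Fin n × Bool)) : geo L L.length = vtx 1 := by
  induction L with
  | nil => rfl
  | cons x L ih =>
    rw [geo]
    split_ifs with h
    · have : L = [] := by
        rw [← List.length_eq_zero_iff]
        simp only [List.length_cons] at h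
        push_cast at h
        have : (L.length : ℝ) ≤ 0 := by linarith
        exact_mod_cast this.antisymm (by positivity)
      subst this
      rw [List.length_singleton, Nat.cast_one]
      exact step_one x (FreeGroup.mk [])
    · simpa using ih

theorem geo_cons_add (x : Fin n × Bool) (L : List (Fin n × Bool)) {t : ℝ} (ht : 0 ≤ t) :
    geo (x :: L) (1 + t) = geo L t := by
  rw [geo]
  split_ifs with h
  · obtain rfl : t = 0 := by linarith
    rw [add_zero, step_one, geo_zero]
  · congr 1; ring

theorem continuous_geo (L : List (Fin n × Bool)) : Continuous (geo L) := by
  induction L with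
  | nil => exact continuous_const
  | cons x L ih =>
    refine Continuous.if_le (continuous_step x _) (ih.comp (by fun_prop)) continuous_id
      continuous_const ?_
    rintro t rfl
    rw [step_one, sub_self, geo_zero]

omit [NeZero n] in
theorem toWord_cases (g : FreeGroup (Fin n)) (i : Fin n) :
    (FreeGroup.of i * g).toWord = (i, true) :: g.toWord ∨
    g.toWord = (i, false) :: (FreeGroup.of i * g).toWord := by
  have h : (FreeGroup.of i * g).toWord = FreeGroup.reduce ((i, true) :: g.toWord) := by
    conv_lhs => rw [← FreeGroup.mk_toWord (x := g)]
    rfl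
  rw [h, FreeGroup.reduce.cons, FreeGroup.reduce_toWord]
  cases hw : g.toWord with
  | nil => simp
  | cons y L =>
    rcases y with ⟨j, b⟩
    simp only
    split_ifs with hc
    · right
      obtain ⟨rfl, hb⟩ := hc
      cases b
      · rfl
      · exact absurd hb (by decide)
    · left; rfl

open Classical in
/-- The contraction on an edge. -/
noncomputable def contr (g : FreeGroup (Fin n)) (i : Fin n) (s τ : I) : Tree n :=
  if (FreeGroup.of i * g).toWord = (i, true) :: g.toWord then
    geo (FreeGroup.of i * g).toWord (1 - s + τ * (g.toWord.length + s))
  else geo g.toWord (s + τ * (g.toWord.length - s))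

/-- The contraction on a vertex. -/
noncomputable def contrV (g : FreeGroup (Fin n)) (τ : I) : Tree n :=
  geo g.toWord (τ * g.toWord.length)

theorem continuous_contr (g : FreeGroup (Fin n)) (i : Fin n) :
    Continuous fun x : I × I => contr g i x.1 x.2 := by
  unfold contr
  split_ifs
  · exact (continuous_geo _).comp (by fun_prop)
  · exact (continuous_geo _).comp (by fun_prop)

theorem continuous_contrV (g : FreeGroup (Fin n)) : Continuous (contrV g) :=
  (continuous_geo _).comp (by fun_prop)

theorem contr_s_zero (g : FreeGroup (Fin n)) (i : Fin n) (τ : I) :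
    contr g i 0 τ = contrV g τ := by
  have hτ := τ.2.1
  unfold contr contrV
  split_ifs with h
  · rw [h]
    simp only [Set.Icc.coe_zero, sub_zero, add_zero]
    exact geo_cons_add _ _ (by positivity)
  · simp

theorem contr_s_one (g : FreeGroup (Fin n)) (i : Fin n) (τ : I) :
    contr g i 1 τ = contrV (FreeGroup.of i * g) τ := by
  have hτ := τ.2.1
  unfold contr contrV
  split_ifs with h
  · rw [h]; simp
  · have h' := (toWord_cases g i).resolve_left h
    rw [h']
    simp only [Set.Icc.coe_one, List.length_cons]
    push_cast
    rw [add_sub_cancel_right]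
    exact geo_cons_add _ _ (by positivity)

theorem contr_zero (g : FreeGroup (Fin n)) (i : Fin n) (s : I) : contr g i s 0 = pt g i s := by
  have h0 := s.2.1
  have h1 := s.2.2
  unfold contr
  split_ifs with h
  · rw [h, geo, if_pos (by simpa using h0)]
    simp [step, FreeGroup.mk_toWord, ptR_coe]
  · have h' := (toWord_cases g i).resolve_left h
    rw [h', geo, if_pos (by simpa using h1)]
    simp [step, FreeGroup.mk_toWord, ptR_coe]

theorem contr_one (g : FreeGroup (Fin n)) (i : Fin n) (s : I) : contr g i s 1 = vtx 1 := by
  unfold contr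
  split_ifs with h
  · rw [← geo_length (FreeGroup.of i * g).toWord, h]
    congr 1
    simp; ring
  · rw [← geo_length g.toWord]
    congr 1
    simp

/-- The contraction. -/
noncomputable def contraction : Tree n → C(I, Tree n) :=
  lift (fun g i s => ⟨contr g i s, (continuous_contr g i).comp (Continuous.prodMk_right s)⟩)
    (fun g => ⟨contrV g, continuous_contrV g⟩)
    (fun g i => ContinuousMap.ext fun τ => contr_s_zero g i τ)
    (fun g i => ContinuousMap.ext fun τ => contr_s_one g i τ)

theorem continuous_contraction : Continuous (contraction (n := n)) :=
  continuous_lift _ _ _ _ fun g i =>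
    (ContinuousMap.curry ⟨fun x : I × I => contr g i x.1 x.2, continuous_contr g i⟩).continuous

instance : ContractibleSpace (Tree n) := by
  rw [contractible_iff_id_nullhomotopic]
  refine ⟨vtx 1, ⟨⟨⟨fun x => contraction x.2 x.1, ?_⟩, ?_, ?_⟩⟩⟩
  · exact continuous_eval.comp ((continuous_contraction.comp continuous_snd).prodMk continuous_fst)
  · intro e
    obtain ⟨g, i, s, rfl⟩ := exists_pt e
    exact contr_zero g i s
  · intro e
    obtain ⟨g, i, s, rfl⟩ := exists_pt e
    exact contr_one g i s

/-! ### The covering map -/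

/-- parametrization of the circle -/
noncomputable def circ (y₀ : Circle) (s : I) : Circle := y₀ * Circle.exp (2 * Real.pi * s)

theorem continuous_circ (y₀ : Circle) : Continuous (circ y₀) := by
  unfold circ; fun_prop

theorem circ_zero (y₀ : Circle) : circ y₀ 0 = y₀ := by simp [circ]

theorem circ_one (y₀ : Circle) : circ y₀ 1 = y₀ := by simp [circ]

theorem circ_surjective (y₀ : Circle) : Function.Surjective (circ y₀) := by
  intro z
  obtain ⟨θ, hθ⟩ := (⟨_, Circle.exp_arg (y₀⁻¹ * z)⟩ : ∃ θ, Circle.exp θ = y₀⁻¹ * z)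
  have hpi : (2 * Real.pi) ≠ 0 := by positivity
  refine ⟨⟨Int.fract (θ / (2 * Real.pi)), Int.fract_nonneg _, (Int.fract_lt_one _).le⟩, ?_⟩
  have : Circle.exp (2 * Real.pi * Int.fract (θ / (2 * Real.pi))) = Circle.exp θ := by
    rw [Circle.exp_eq_exp]
    refine ⟨-⌊θ / (2 * Real.pi)⌋, ?_⟩
    rw [Int.fract]
    push_cast
    field_simp
    ring
  rw [circ, this, hθ]
  simp

theorem circ_eq (y₀ : Circle) {s t : I} (h : circ y₀ s = circ y₀ t) :
    s = t ∨ (s = 0 ∧ t = 1) ∨ (s = 1 ∧ t = 0) := by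
  unfold circ at h
  rw [mul_right_inj, Circle.exp_eq_exp] at h
  obtain ⟨m, hm⟩ := h
  have hpi : (0 : ℝ) < 2 * Real.pi := by positivity
  have hm' : (s : ℝ) = t + m := by
    apply mul_left_cancel₀ hpi.ne'
    rw [hm]; ring
  have hs0 := s.2.1
  have hs1 := s.2.2
  have ht0 := t.2.1
  have ht1 := t.2.2
  have m1 : m ≤ 1 := by
    have : (m : ℝ) ≤ 1 := by linarith
    exact_mod_cast this
  have m2 : -1 ≤ m := by
    have : (-1 : ℝ) ≤ m := by linarith
    exact_mod_cast this
  have : m = -1 ∨ m = 0 ∨ m = 1 := by omega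
  rcases this with rfl | rfl | rfl
  · right; left
    push_cast at hm'
    exact ⟨Subtype.ext (by push_cast; linarith), Subtype.ext (by push_cast; linarith)⟩
  · left
    exact Subtype.ext (by simpa using hm')
  · right; right
    push_cast at hm'
    exact ⟨Subtype.ext (by push_cast; linarith), Subtype.ext (by push_cast; linarith)⟩

/-- The wedge. -/
abbrev Wedge (n : ℕ) (y₀ : Circle) := Quot (paperRel n ({y₀} : Set Circle))

theorem wedge_eq_iff (y₀ : Circle) (z w : Fin n × Circle) :
    (Quot.mk _ z : Wedge n y₀) = Quot.mk _ w ↔ paperRel n ({y₀} : Set Circle) z w := by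
  refine ⟨fun h => ?_, Quot.sound⟩
  have eqv : Equivalence (paperRel n ({y₀} : Set Circle)) := by
    refine ⟨fun z => ⟨rfl, .inr rfl⟩, ?_, ?_⟩
    · rintro z w ⟨h, h'⟩
      exact ⟨h.symm, h'.imp (fun h' => h ▸ h') Eq.symm⟩
    · rintro z w u ⟨h, h'⟩ ⟨k, k'⟩
      refine ⟨h.trans k, ?_⟩
      rcases h' with h' | h'
      · exact .inl h'
      · rcases k' with k' | k'
        · exact .inl (h ▸ k')
        · exact .inr (h'.trans k')
  exact eqv.eqvGen_iff.1 (Quot.eqvGen_exact h)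

/-- The covering map. -/
noncomputable def proj (y₀ : Circle) : Tree n → Wedge n y₀ :=
  lift (fun _ i s => Quot.mk _ (i, circ y₀ s)) (fun _ => Quot.mk _ (0, y₀))
    (fun g i => Quot.sound ⟨circ_zero y₀, .inl (circ_zero y₀)⟩)
    (fun g i => Quot.sound ⟨circ_one y₀, .inl (circ_one y₀)⟩)

theorem proj_pt (y₀ : Circle) (g : FreeGroup (Fin n)) (i : Fin n) (s : I) :
    proj y₀ (pt g i s) = Quot.mk _ (i, circ y₀ s) := rfl

theorem proj_vtx (y₀ : Circle) (g : FreeGroup (Fin n)) :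
    proj y₀ (vtx g) = Quot.mk _ (0, y₀) := by
  rw [vtx, proj_pt, circ_zero]

theorem continuous_proj (y₀ : Circle) : Continuous (proj (n := n) y₀) :=
  continuous_lift _ _ _ _ fun g i => continuous_quot_mk.comp
    (continuous_const.prodMk (continuous_circ y₀))

theorem isQuotientMap_proj (y₀ : Circle) : IsQuotientMap (proj (n := n) y₀) := by
  have hf : Continuous fun x : Fin n × I => pt (1 : FreeGroup (Fin n)) x.1 x.2 :=
    continuous_prod_of_discrete_left.2 fun i => continuous_pt 1 i
  refine IsQuotientMap.of_comp hf (continuous_proj y₀) ?_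
  have hg : Continuous (Prod.map id (circ y₀) : Fin n × I → Fin n × Circle) :=
    continuous_id.prodMap (continuous_circ y₀)
  have h2 := hg.isClosedMap.isQuotientMap hg
    (Function.surjective_id.prodMap (circ_surjective y₀))
  exact (isQuotientMap_quot_mk (r := paperRel n ({y₀} : Set Circle))).comp h2

theorem proj_smul (y₀ : Circle) (k : FreeGroup (Fin n)) (e : Tree n) :
    proj y₀ (k • e) = proj y₀ e := by
  obtain ⟨g, i, s, rfl⟩ := exists_pt e
  rfl

theorem vtx_mem_orbit (g h : FreeGroup (Fin n)) :
    vtx g ∈ MulAction.orbit (FreeGroup (Fin n)) (vtx h) :=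
  ⟨g⁻¹ * h, by simp [smul_vtx]⟩

theorem circ_ne (y₀ : Circle) {s : I} (h0 : 0 < s) (h1 : s < 1) : circ y₀ s ≠ y₀ := by
  intro h
  rw [← circ_zero y₀, circ_zero, ← circ_zero y₀] at h
  rcases circ_eq (circ y₀ 0) (s := s) (t := 0) (by simpa [circ_zero] using h) with h | h | h
  · exact h0.ne' h
  · exact h0.ne' h.1
  · exact h1.ne h.1

theorem isQuotientCoveringMap_proj (y₀ : Circle) :
    IsQuotientCoveringMap (proj (n := n) y₀) (FreeGroup (Fin n)) where
  __ := isQuotientMap_proj y₀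
  continuous_const_smul := continuous_const_smul
  disjoint := exists_disjoint
  apply_eq_iff_mem_orbit {e₁ e₂} := by
    constructor
    · intro h
      rcases vtx_or e₁ with ⟨k, rfl⟩ | ⟨k, i, s, h0, h1, rfl⟩ <;>
      rcases vtx_or e₂ with ⟨l, rfl⟩ | ⟨l, j, t, k0, k1, rfl⟩
      · exact vtx_mem_orbit _ _
      · rw [proj_vtx, proj_pt, wedge_eq_iff] at h
        exact absurd h.1.symm (circ_ne y₀ k0 k1)
      · rw [proj_vtx, proj_pt, wedge_eq_iff] at h
        exact absurd h.1 (circ_ne y₀ h0 h1)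
      · rw [proj_pt, proj_pt, wedge_eq_iff] at h
        obtain ⟨h, h'⟩ := h
        obtain rfl : i = j := h'.resolve_left (circ_ne y₀ h0 h1)
        obtain rfl : s = t := by
          rcases circ_eq y₀ h with h | h | h
          · exact h
          · exact absurd h.1 h0.ne'
          · exact absurd h.1 h1.ne
        exact ⟨k⁻¹ * l, by simp [smul_pt]⟩
    · rintro ⟨k, rfl⟩
      exact proj_smul y₀ k e₂

end WedgeCover

/-- For `Y = S¹ = {w ∈ ℂ : |w| = 1}` and `Y₁ = {y₀}`, the quotient
`Z/∼` of `Z = Fin n × S¹` (the wedge of `n` circles joined at the point coming from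
`y₀`) has fundamental group, based at the wedge point, isomorphic to the free group
on `n` generators. -/
theorem wedge_of_circles_fundamentalGroup (n : ℕ) (hn : 0 < n) (y₀ : Circle) :
    Nonempty (FundamentalGroup (Quot (paperRel n ({y₀} : Set Circle)))
      (Quot.mk (paperRel n ({y₀} : Set Circle)) (⟨0, hn⟩, y₀)) ≃*
      FreeGroup (Fin n)) := by
  haveI : NeZero n := ⟨hn.ne'⟩
  exact ⟨((WedgeCover.isQuotientCoveringMap_proj (n := n) y₀).fundamentalGroupEquiv
    ⟨WedgeCover.vtx 1, WedgeCover.proj_vtx y₀ 1⟩).trans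
      (MulEquiv.inv' (FreeGroup (Fin n))).symm⟩
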